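/- Under the flow with the stated boundary conditions, the squared L² norm of curvature evolves by (d/dt) ∫_γ k² ds = − 2 ∫_γ k_{s³}² ds + 5 ∫_γ k_{ss}² k² ds + 5 ∫_γ k_{ss} k_s² k ds + ∫_γ k_{ss} k⁵ ds − (1/2) ∫_γ k_s² k⁴ ds. -/

import Mathlib

noncomputable section

open Real Set MeasureTheory intervalIntegral
open scoped ENNReal RealInnerProductSpace

/-- The Euclidean plane. -/
abbrev E2 : Type := EuclideanSpace ℝ (Fin 2)

/-- Counterclockwise rotation by `π/2`. -/
def rot (v : E2) : E2 := (WithLp.equiv 2 (Fin 2 → ℝ)).symm ![-(v 1), v 0]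

/-- Arc length derivative `∂ₛ = |∂ₓγ|⁻¹ ∂ₓ` of a scalar function along the curve `γ`. -/
def aderiv (γ : ℝ → E2) (f : ℝ → ℝ) (x : ℝ) : ℝ := (‖deriv γ x‖)⁻¹ * deriv f x

/-- Iterated arc length derivative. -/
def aderivIter (γ : ℝ → E2) : ℕ → (ℝ → ℝ) → (ℝ → ℝ)
  | 0, f => f
  | n + 1, f => aderiv γ (aderivIter γ n f)

/-- Arc length derivative of a vector-valued function along `γ`. -/
def aderivVec (γ : ℝ → E2) (f : ℝ → E2) (x : ℝ) : E2 := (‖deriv γ x‖)⁻¹ • deriv f x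

/-- Unit tangent vector `τ = ∂ₛ γ`. -/
def utangent (γ : ℝ → E2) (x : ℝ) : E2 := aderivVec γ γ x

/-- Unit normal `ν`, the counterclockwise rotation of `τ` by `π/2`. -/
def unormal (γ : ℝ → E2) (x : ℝ) : E2 := rot (utangent γ x)

/-- Scalar curvature `k = ⟨∂ₛτ, ν⟩`. -/
def curv (γ : ℝ → E2) (x : ℝ) : ℝ := ⟪aderivVec γ (utangent γ) x, unormal γ x⟫

/-- `j`-th arc length derivative of the curvature, `k_{s^j}`. -/
def kds (γ : ℝ → E2) (j : ℕ) : ℝ → ℝ := aderivIter γ j (curv γ)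

/-- The normal speed `F = k_{s⁴} + k² k_{ss} - (1/2) k k_s²`. -/
def speedF (γ : ℝ → E2) (x : ℝ) : ℝ :=
  kds γ 4 x + (curv γ x) ^ 2 * kds γ 2 x - (1 / 2) * curv γ x * (kds γ 1 x) ^ 2

/-- `∫_γ f ds`, the integral of `f` along `γ : [-1,1] → ℝ²` with respect to arc length. -/
def cint (γ : ℝ → E2) (f : ℝ → ℝ) : ℝ := ∫ x in (-1:ℝ)..1, f x * ‖deriv γ x‖

/-- The length of `γ`. -/
def clen (γ : ℝ → E2) : ℝ := cint γ (fun _ => 1)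

/-- `‖k_{s^j}‖₂² = ∫_γ k_{s^j}² ds`. -/
def knorm2 (γ : ℝ → E2) (j : ℕ) : ℝ := cint γ (fun x => (kds γ j x) ^ 2)

/-- Total curvature `∫_γ k ds`. -/
def totalK (γ : ℝ → E2) : ℝ := cint γ (curv γ)

/-- The time interval `[0, T)`, `T ∈ (0, ∞]`. -/
def inTime (T : ℝ≥0∞) (t : ℝ) : Prop := 0 ≤ t ∧ ENNReal.ofReal t < T

/-- A smooth family of regular plane curves `γ : [-1,1] × [0,T) → ℝ²` moving with
normal speed `F = k_{s⁴} + k² k_{ss} - (1/2) k k_s²`, i.e. `∂ₜγ = F ν`. -/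
structure SixthFlow (T : ℝ≥0∞) where
  Tpos : 0 < T
  γ : ℝ → ℝ → E2
  smooth : ContDiff ℝ (⊤ : ℕ∞) (Function.uncurry γ)
  regular : ∀ ⦃t x : ℝ⦄, inTime T t → x ∈ Icc (-1:ℝ) 1 → deriv (γ t) x ≠ 0
  flow : ∀ ⦃t x : ℝ⦄, inTime T t → x ∈ Icc (-1:ℝ) 1 →
    HasDerivWithinAt (fun u => γ u x) (speedF (γ t) x • unormal (γ t) x) (Ici 0) t

/-- The boundary conditions: the endpoints of the curve lie on two fixed parallel vertical
lines at distance `|e| > 0` (at abscissae `lineMinus` and `linePlus`), the curve meets these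
lines perpendicularly (Neumann condition: the unit normal of the curve is orthogonal to the
unit normal `(1,0)` of the lines), and `k_s = k_{sss} = 0` at both endpoints. -/
structure BC {T : ℝ≥0∞} (Φ : SixthFlow T) (e : ℝ) where
  he : e ≠ 0
  lineMinus : ℝ
  linePlus : ℝ
  hdist : |linePlus - lineMinus| = |e|
  onLeft : ∀ ⦃t : ℝ⦄, inTime T t → Φ.γ t (-1) 0 = lineMinus
  onRight : ∀ ⦃t : ℝ⦄, inTime T t → Φ.γ t 1 0 = linePlus
  neumann : ∀ ⦃t : ℝ⦄, inTime T t →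
    unormal (Φ.γ t) (-1) 0 = 0 ∧ unormal (Φ.γ t) 1 0 = 0
  noflux : ∀ ⦃t : ℝ⦄, inTime T t →
    kds (Φ.γ t) 1 (-1) = 0 ∧ kds (Φ.γ t) 1 1 = 0
  noflux3 : ∀ ⦃t : ℝ⦄, inTime T t →
    kds (Φ.γ t) 3 (-1) = 0 ∧ kds (Φ.γ t) 3 1 = 0

open Filter Topology

/-- Differentiation under the integral sign over a compact interval. -/
theorem hasDerivAt_intervalIntegral_of_contDiffOn {J : ℝ × ℝ → ℝ} {W : Set (ℝ × ℝ)}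
    (hW : IsOpen W) (hJ : ContDiffOn ℝ 1 J W) {a b t : ℝ} (hab : a ≤ b)
    (hsub : ∀ x ∈ Icc a b, (t, x) ∈ W) :
    HasDerivAt (fun u => ∫ x in a..b, J (u, x)) (∫ x in a..b, fderiv ℝ J (t, x) (1, 0)) t := by
  have hK : ({t} : Set ℝ) ×ˢ Icc a b ⊆ W := by
    rintro ⟨u, x⟩ ⟨hu, hx⟩
    rw [mem_singleton_iff] at hu
    subst hu
    exact hsub x hx
  obtain ⟨u, v, hu, -, htu, hxv, huv⟩ :=
    generalized_tube_lemma isCompact_singleton isCompact_Icc hW hK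
  obtain ⟨ε, hε, hball⟩ := Metric.nhds_basis_closedBall.mem_iff.1
    (hu.mem_nhds (htu (mem_singleton t)))
  have hsubW : Metric.closedBall t ε ×ˢ Icc a b ⊆ W := (prod_mono hball hxv).trans huv
  have hdiff : ∀ p ∈ W, HasFDerivAt J (fderiv ℝ J p) p := fun p hp =>
    ((hJ.differentiableOn (by norm_num)).differentiableAt (hW.mem_nhds hp)).hasFDerivAt
  have hcont : ContinuousOn (fun p => fderiv ℝ J p (1, 0)) W :=
    (hJ.continuousOn_fderiv_of_isOpen hW le_rfl).clm_apply continuousOn_const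
  obtain ⟨C, hC⟩ := ((isCompact_closedBall t ε).prod isCompact_Icc).exists_bound_of_continuousOn
    (hcont.mono hsubW)
  have hslice : ∀ {f : ℝ × ℝ → ℝ}, ContinuousOn f W → ∀ u ∈ Metric.closedBall t ε,
      IntervalIntegrable (fun x => f (u, x)) volume a b := by
    intro f hf u hu
    refine ContinuousOn.intervalIntegrable ?_
    rw [uIcc_of_le hab]
    exact hf.comp (by fun_prop) fun x hx => hsubW ⟨hu, hx⟩
  have ht : t ∈ Metric.closedBall t ε := Metric.mem_closedBall_self hε.le
  have hIoc : ∀ x ∈ uIoc a b, x ∈ Icc a b := fun x hx => by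
    rw [uIoc_of_le hab] at hx
    exact Ioc_subset_Icc_self hx
  refine (hasDerivAt_integral_of_dominated_loc_of_deriv_le (F := fun u x => J (u, x))
    (F' := fun u x => fderiv ℝ J (u, x) (1, 0)) (bound := fun _ => C)
    (Metric.closedBall_mem_nhds t hε) ?_ (hslice hJ.continuousOn t ht)
    (hslice hcont t ht).aestronglyMeasurable_restrict_uIoc ?_ intervalIntegrable_const ?_).2
  · filter_upwards [Metric.closedBall_mem_nhds t hε] with u hu
    exact (hslice hJ.continuousOn u hu).aestronglyMeasurable_restrict_uIoc
  · exact Eventually.of_forall fun x hx u hu => hC (u, x) ⟨hu, hIoc x hx⟩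
  · refine Eventually.of_forall fun x hx u hu => ?_
    exact (hdiff (u, x) (hsubW ⟨hu, hIoc x hx⟩)).comp_hasDerivAt u
      ((hasDerivAt_id u).prodMk (hasDerivAt_const u x))

/-- Directional derivatives of a smooth map commute. -/
theorem fderiv_fderiv_apply_comm {E G : Type*} [NormedAddCommGroup E] [NormedSpace ℝ E]
    [NormedAddCommGroup G] [NormedSpace ℝ G] {f : E → G} (hf : ContDiff ℝ (⊤ : ℕ∞) f)
    (p v w : E) :
    fderiv ℝ (fun q => fderiv ℝ f q v) p w = fderiv ℝ (fun q => fderiv ℝ f q w) p v := by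
  have h : HasFDerivAt (fderiv ℝ f) (fderiv ℝ (fderiv ℝ f) p) p :=
    ((hf.fderiv_right (m := 1) (by norm_cast)).differentiable (by norm_num) p).hasFDerivAt
  have happ : ∀ z, HasFDerivAt (fun q => fderiv ℝ f q z)
      ((ContinuousLinearMap.apply ℝ G z).comp (fderiv ℝ (fderiv ℝ f) p)) p := fun z =>
    (ContinuousLinearMap.apply ℝ G z).hasFDerivAt.comp p h
  rw [(happ v).fderiv, (happ w).fderiv]
  exact second_derivative_symmetric
    (fun q => (hf.differentiable (by simp) q).hasFDerivAt) h w v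

/-- A directional derivative of a smooth map is smooth. -/
theorem ContDiff.fderiv_apply_const {E G : Type*} [NormedAddCommGroup E] [NormedSpace ℝ E]
    [NormedAddCommGroup G] [NormedSpace ℝ G] {f : E → G} (hf : ContDiff ℝ (⊤ : ℕ∞) f) (v : E) :
    ContDiff ℝ (⊤ : ℕ∞) (fun q => fderiv ℝ f q v) :=
  (hf.fderiv_right (m := (⊤ : ℕ∞)) (by norm_cast)).clm_apply contDiff_const

theorem hasDerivAt_slice_fst {G : Type*} [NormedAddCommGroup G] [NormedSpace ℝ G]
    {f : ℝ × ℝ → G} {u x : ℝ} (hf : DifferentiableAt ℝ f (u, x)) :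
    HasDerivAt (fun s => f (s, x)) (fderiv ℝ f (u, x) (1, 0)) u :=
  hf.hasFDerivAt.comp_hasDerivAt u ((hasDerivAt_id u).prodMk (hasDerivAt_const u x))

theorem hasDerivAt_slice_snd {G : Type*} [NormedAddCommGroup G] [NormedSpace ℝ G]
    {f : ℝ × ℝ → G} {u x : ℝ} (hf : DifferentiableAt ℝ f (u, x)) :
    HasDerivAt (fun y => f (u, y)) (fderiv ℝ f (u, x) (0, 1)) x :=
  hf.hasFDerivAt.comp_hasDerivAt x ((hasDerivAt_const x u).prodMk (hasDerivAt_id x))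

theorem HasDerivAt.eq_of_eqOn_Icc {f g : ℝ → ℝ} {f' g' a b x : ℝ} (hab : a < b)
    (h : EqOn f g (Icc a b)) (hx : x ∈ Icc a b) (hf : HasDerivAt f f' x)
    (hg : HasDerivAt g g' x) : f' = g' :=
  (uniqueDiffOn_Icc hab x hx).eq_deriv _ hf.hasDerivWithinAt
    (hg.hasDerivWithinAt.congr h (h hx))

theorem HasDerivAt.euclidean_apply {f : ℝ → E2} {f' : E2} {x : ℝ} (h : HasDerivAt f f' x)
    (i : Fin 2) : HasDerivAt (fun y => f y i) (f' i) x :=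
  (EuclideanSpace.proj (𝕜 := ℝ) i).hasFDerivAt.comp_hasDerivAt x h

theorem norm_sq_E2 (v : E2) : ‖v‖ ^ 2 = v 0 ^ 2 + v 1 ^ 2 := by
  simp [EuclideanSpace.norm_sq_eq, Fin.sum_univ_two]

@[simp] theorem rot_apply_zero (v : E2) : rot v 0 = -v 1 := rfl

@[simp] theorem rot_apply_one (v : E2) : rot v 1 = v 0 := rfl

theorem inner_E2 (v w : E2) : ⟪v, w⟫ = v 0 * w 0 + v 1 * w 1 := by
  simp [PiLp.inner_apply, Fin.sum_univ_two, mul_comm]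

/-! ### A fixed regular curve -/

/-- The set of parameters at which `c` is regular. -/
def regSet (c : ℝ → E2) : Set ℝ := {x | deriv c x ≠ 0}

section Curve

variable {c : ℝ → E2}

theorem contDiff_deriv_curve (hc : ContDiff ℝ (⊤ : ℕ∞) c) : ContDiff ℝ (⊤ : ℕ∞) (deriv c) :=
  (contDiff_infty_iff_deriv.1 hc).2

theorem isOpen_regSet (hc : ContDiff ℝ (⊤ : ℕ∞) c) : IsOpen (regSet c) :=
  isOpen_ne_fun (contDiff_deriv_curve hc).continuous continuous_const

theorem norm_deriv_pos {x : ℝ} (hx : x ∈ regSet c) : 0 < ‖deriv c x‖ := norm_pos_iff.2 hx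

theorem contDiffOn_speed (hc : ContDiff ℝ (⊤ : ℕ∞) c) :
    ContDiffOn ℝ (⊤ : ℕ∞) (fun x => ‖deriv c x‖) (regSet c) :=
  (contDiff_deriv_curve hc).contDiffOn.norm ℝ fun _ hx => hx

theorem contDiffOn_speed_inv (hc : ContDiff ℝ (⊤ : ℕ∞) c) :
    ContDiffOn ℝ (⊤ : ℕ∞) (fun x => (‖deriv c x‖)⁻¹) (regSet c) :=
  (contDiffOn_speed hc).inv fun _ hx => (norm_deriv_pos hx).ne'

theorem contDiffOn_utangent (hc : ContDiff ℝ (⊤ : ℕ∞) c) :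
    ContDiffOn ℝ (⊤ : ℕ∞) (utangent c) (regSet c) :=
  (contDiffOn_speed_inv hc).smul (contDiff_deriv_curve hc).contDiffOn

theorem ContDiffOn.euclidean_apply {f : ℝ → E2} {s : Set ℝ} (h : ContDiffOn ℝ (⊤ : ℕ∞) f s)
    (i : Fin 2) : ContDiffOn ℝ (⊤ : ℕ∞) (fun x => f x i) s :=
  (EuclideanSpace.proj (𝕜 := ℝ) i).contDiff.comp_contDiffOn h

theorem ContDiffOn.deriv_regSet {G : Type*} [NormedAddCommGroup G] [NormedSpace ℝ G]
    (hc : ContDiff ℝ (⊤ : ℕ∞) c) {f : ℝ → G}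
    (h : ContDiffOn ℝ (⊤ : ℕ∞) f (regSet c)) : ContDiffOn ℝ (⊤ : ℕ∞) (deriv f) (regSet c) :=
  h.deriv_of_isOpen (isOpen_regSet hc) (by norm_cast)

theorem ContDiffOn.hasDerivAt_regSet {G : Type*} [NormedAddCommGroup G] [NormedSpace ℝ G]
    (hc : ContDiff ℝ (⊤ : ℕ∞) c) {f : ℝ → G} (h : ContDiffOn ℝ (⊤ : ℕ∞) f (regSet c)) {x : ℝ}
    (hx : x ∈ regSet c) : HasDerivAt f (deriv f x) x :=
  ((h.differentiableOn (by simp)).differentiableAt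
    ((isOpen_regSet hc).mem_nhds hx)).hasDerivAt

theorem curv_eq (c : ℝ → E2) (x : ℝ) : curv c x = (‖deriv c x‖)⁻¹ *
    (deriv (utangent c) x 1 * utangent c x 0 - deriv (utangent c) x 0 * utangent c x 1) := by
  simp only [curv, aderivVec, unormal, inner_E2, rot_apply_zero, rot_apply_one, PiLp.smul_apply,
    smul_eq_mul]
  ring

theorem contDiffOn_curv (hc : ContDiff ℝ (⊤ : ℕ∞) c) :
    ContDiffOn ℝ (⊤ : ℕ∞) (curv c) (regSet c) := by
  have hτ := contDiffOn_utangent hc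
  have hτ' := ContDiffOn.deriv_regSet hc hτ
  refine ((contDiffOn_speed_inv hc).mul (((hτ'.euclidean_apply 1).mul (hτ.euclidean_apply 0)).sub
    ((hτ'.euclidean_apply 0).mul (hτ.euclidean_apply 1)))).congr fun x _ => curv_eq c x

theorem contDiffOn_kds (hc : ContDiff ℝ (⊤ : ℕ∞) c) (j : ℕ) :
    ContDiffOn ℝ (⊤ : ℕ∞) (kds c j) (regSet c) := by
  induction j with
  | zero => exact contDiffOn_curv hc
  | succ n ih => exact (contDiffOn_speed_inv hc).mul (ContDiffOn.deriv_regSet hc ih)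

theorem hasDerivAt_kds (hc : ContDiff ℝ (⊤ : ℕ∞) c) (j : ℕ) {x : ℝ} (hx : x ∈ regSet c) :
    HasDerivAt (kds c j) (‖deriv c x‖ * kds c (j + 1) x) x := by
  refine (ContDiffOn.hasDerivAt_regSet hc (contDiffOn_kds hc j) hx).congr_deriv ?_
  have hsucc : kds c (j + 1) x = (‖deriv c x‖)⁻¹ * deriv (kds c j) x := rfl
  rw [hsucc, mul_inv_cancel_left₀ (norm_deriv_pos hx).ne']

theorem contDiffOn_speedF (hc : ContDiff ℝ (⊤ : ℕ∞) c) :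
    ContDiffOn ℝ (⊤ : ℕ∞) (speedF c) (regSet c) :=
  ((contDiffOn_kds hc 4).add (((contDiffOn_curv hc).pow 2).mul (contDiffOn_kds hc 2))).sub
    ((contDiffOn_const.mul (contDiffOn_curv hc)).mul ((contDiffOn_kds hc 1).pow 2))

theorem utangent_sq {x : ℝ} (hx : x ∈ regSet c) :
    utangent c x 0 ^ 2 + utangent c x 1 ^ 2 = 1 := by
  rw [← norm_sq_E2, utangent, aderivVec, norm_smul, norm_inv, norm_norm,
    inv_mul_cancel₀ (norm_deriv_pos hx).ne', one_pow]

theorem deriv_curve_apply {x : ℝ} (hx : x ∈ regSet c) (i : Fin 2) :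
    deriv c x i = ‖deriv c x‖ * utangent c x i := by
  rw [utangent, aderivVec, PiLp.smul_apply, smul_eq_mul,
    mul_inv_cancel_left₀ (norm_deriv_pos hx).ne']

/-- Frenet equations in coordinates. -/
theorem hasDerivAt_utangent (hc : ContDiff ℝ (⊤ : ℕ∞) c) {x : ℝ} (hx : x ∈ regSet c) :
    HasDerivAt (fun y => utangent c y 0) (-(‖deriv c x‖ * curv c x * utangent c x 1)) x ∧
    HasDerivAt (fun y => utangent c y 1) (‖deriv c x‖ * curv c x * utangent c x 0) x := by
  have h := ContDiffOn.hasDerivAt_regSet hc (contDiffOn_utangent hc) hx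
  have h0 := h.euclidean_apply 0
  have h1 := h.euclidean_apply 1
  have hone := utangent_sq hx
  have horth : utangent c x 0 * deriv (utangent c) x 0
      + utangent c x 1 * deriv (utangent c) x 1 = 0 := by
    have hd := (h0.pow 2).add (h1.pow 2)
    have hev : (fun y => utangent c y 0 ^ 2 + utangent c y 1 ^ 2) =ᶠ[𝓝 x] fun _ => 1 := by
      filter_upwards [(isOpen_regSet hc).mem_nhds hx] with y hy using utangent_sq hy
    have := hd.unique ((hasDerivAt_const x (1 : ℝ)).congr_of_eventuallyEq hev)
    norm_num at this
    linarith
  have hk : ‖deriv c x‖ * curv c x = deriv (utangent c) x 1 * utangent c x 0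
      - deriv (utangent c) x 0 * utangent c x 1 := by
    rw [curv_eq, mul_inv_cancel_left₀ (norm_deriv_pos hx).ne']
  rw [hk]
  constructor
  · convert h0 using 1
    linear_combination (deriv (utangent c) x 0) * hone - utangent c x 0 * horth
  · convert h1 using 1
    linear_combination (deriv (utangent c) x 1) * hone - utangent c x 1 * horth

theorem deriv_deriv_curve_apply (hc : ContDiff ℝ (⊤ : ℕ∞) c) {x : ℝ} (hx : x ∈ regSet c) :
    deriv (deriv c) x 0 = deriv (fun y => ‖deriv c y‖) x * utangent c x 0
      - ‖deriv c x‖ ^ 2 * curv c x * utangent c x 1 ∧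
    deriv (deriv c) x 1 = deriv (fun y => ‖deriv c y‖) x * utangent c x 1
      + ‖deriv c x‖ ^ 2 * curv c x * utangent c x 0 := by
  have h := ContDiffOn.hasDerivAt_regSet hc (contDiff_deriv_curve hc).contDiffOn hx
  have hg := ContDiffOn.hasDerivAt_regSet hc (contDiffOn_speed hc) hx
  obtain ⟨h0, h1⟩ := hasDerivAt_utangent hc hx
  have hev : ∀ i, (fun y => deriv c y i) =ᶠ[𝓝 x] fun y => ‖deriv c y‖ * utangent c y i := by
    intro i
    filter_upwards [(isOpen_regSet hc).mem_nhds hx] with y hy using deriv_curve_apply hy i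
  constructor
  · rw [(h.euclidean_apply 0).unique ((hg.mul h0).congr_of_eventuallyEq (hev 0))]
    ring
  · rw [(h.euclidean_apply 1).unique ((hg.mul h1).congr_of_eventuallyEq (hev 1))]
    ring

/-- The curvature integrand in terms of parameter derivatives. -/
def energyDensity (a b : E2) : ℝ := ((a 0 * b 1 - a 1 * b 0) / ‖a‖ ^ 3) ^ 2 * ‖a‖

theorem energyDensity_deriv (hc : ContDiff ℝ (⊤ : ℕ∞) c) {x : ℝ} (hx : x ∈ regSet c) :
    energyDensity (deriv c x) (deriv (deriv c) x) = kds c 0 x ^ 2 * ‖deriv c x‖ := by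
  obtain ⟨h0, h1⟩ := deriv_deriv_curve_apply hc hx
  have hg := norm_deriv_pos hx
  rw [energyDensity, h0, h1, deriv_curve_apply hx 0, deriv_curve_apply hx 1]
  congr 2
  rw [div_eq_iff (by positivity)]
  change _ = curv c x * _
  linear_combination ‖deriv c x‖ ^ 3 * curv c x * utangent_sq hx

end Curve

theorem hasDerivAt_energyDensity {a b : ℝ → E2} {a' b' : E2} {t g k g₁ F F₁ F₂ M p q : ℝ}
    (ha : HasDerivAt a a' t) (hb : HasDerivAt b b' t) (hg : 0 < g) (hpq : p ^ 2 + q ^ 2 = 1)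
    (ha₀ : a t 0 = g * p) (ha₁ : a t 1 = g * q) (hb₀ : b t 0 = g₁ * p - g ^ 2 * k * q)
    (hb₁ : b t 1 = g₁ * q + g ^ 2 * k * p)
    (ha'₀ : a' 0 = -(F₁ * q) - F * g * k * p) (ha'₁ : a' 1 = F₁ * p - F * g * k * q)
    (hb'₀ : b' 0 = -(F₂ * q) - F₁ * g * k * p - M * p + F * g ^ 2 * k ^ 2 * q)
    (hb'₁ : b' 1 = F₂ * p - F₁ * g * k * q - M * q - F * g ^ 2 * k ^ 2 * p) :
    HasDerivAt (fun u => energyDensity (a u) (b u))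
      (2 * k * (F₂ / g - g₁ * F₁ / g ^ 2) + k ^ 3 * F * g) t := by
  have hnorm : ‖a t‖ = g := by
    have : ‖a t‖ ^ 2 = g ^ 2 := by
      rw [norm_sq_E2, ha₀, ha₁]
      linear_combination g ^ 2 * hpq
    exact (pow_left_inj₀ (norm_nonneg _) hg.le two_ne_zero).1 this
  have hN : HasDerivAt (fun u => ‖a u‖) (-(F * g * k)) t := by
    have h := (((ha.euclidean_apply 0).pow 2).add ((ha.euclidean_apply 1).pow 2)).sqrt
      (by simp only [Pi.add_apply, Pi.pow_apply, ← norm_sq_E2, hnorm]; positivity)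
    have hfun : (fun u => ‖a u‖) = fun u => √(a u 0 ^ 2 + a u 1 ^ 2) := by
      funext u
      rw [← norm_sq_E2, Real.sqrt_sq (norm_nonneg _)]
    rw [hfun]
    refine h.congr_deriv ?_
    have hs : √(((fun y => a y 0) ^ 2 + (fun y => a y 1) ^ 2) t) = g := by
      simp only [Pi.add_apply, Pi.pow_apply, ← norm_sq_E2, hnorm, Real.sqrt_sq hg.le]
    rw [hs, ha₀, ha₁, ha'₀, ha'₁, div_eq_iff (by positivity)]
    norm_num
    linear_combination (-2 * F * g ^ 2 * k) * hpq
  have hC := ((ha.euclidean_apply 0).mul (hb.euclidean_apply 1)).sub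
    ((ha.euclidean_apply 1).mul (hb.euclidean_apply 0))
  have hCt : a t 0 * b t 1 - a t 1 * b t 0 = g ^ 3 * k := by
    rw [ha₀, ha₁, hb₀, hb₁]
    linear_combination g ^ 3 * k * hpq
  have hCt' : a' 0 * b t 1 + a t 0 * b' 1 - (a' 1 * b t 0 + a t 1 * b' 0)
      = g * F₂ - g₁ * F₁ - 2 * F * k ^ 2 * g ^ 3 := by
    rw [ha₀, ha₁, hb₀, hb₁, ha'₀, ha'₁, hb'₀, hb'₁]
    linear_combination (g * F₂ - g₁ * F₁ - 2 * F * k ^ 2 * g ^ 3) * hpq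
  rw [hCt'] at hC
  have hmain := ((hC.div (hN.pow 3) (by simp only [Pi.pow_apply, hnorm]; positivity)).pow 2).mul hN
  refine (hmain.congr_deriv ?_)
  simp only [Pi.sub_apply, Pi.mul_apply, Pi.div_apply, Pi.pow_apply, hnorm, hCt]
  field_simp
  ring

theorem normal_variation_derivs {c : ℝ → E2} (hc : ContDiff ℝ (⊤ : ℕ∞) c) {a b : ℝ} (hab : a < b)
    (hreg : Icc a b ⊆ regSet c) {f : ℝ → ℝ} (hf : ContDiffOn ℝ (⊤ : ℕ∞) f (regSet c))
    {V V₁ V₂ : ℝ → E2} (hV : ∀ x, HasDerivAt V (V₁ x) x) (hV₁ : ∀ x, HasDerivAt V₁ (V₂ x) x)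
    (h : ∀ x ∈ Icc a b, V x = f x • unormal c x) {x : ℝ} (hx : x ∈ Icc a b) :
    (V₁ x 0 = -(deriv f x * utangent c x 1)
        - f x * ‖deriv c x‖ * curv c x * utangent c x 0) ∧
    (V₁ x 1 = deriv f x * utangent c x 0 - f x * ‖deriv c x‖ * curv c x * utangent c x 1) ∧
    (V₂ x 0 = -(deriv (deriv f) x * utangent c x 1)
        - deriv f x * ‖deriv c x‖ * curv c x * utangent c x 0
        - deriv (fun y => f y * ‖deriv c y‖ * curv c y) x * utangent c x 0
        + f x * ‖deriv c x‖ ^ 2 * curv c x ^ 2 * utangent c x 1) ∧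
    (V₂ x 1 = deriv (deriv f) x * utangent c x 0
        - deriv f x * ‖deriv c x‖ * curv c x * utangent c x 1
        - deriv (fun y => f y * ‖deriv c y‖ * curv c y) x * utangent c x 1
        - f x * ‖deriv c x‖ ^ 2 * curv c x ^ 2 * utangent c x 0) := by
  have hd : ∀ y ∈ Icc a b, HasDerivAt f (deriv f y) y := fun y hy =>
    ContDiffOn.hasDerivAt_regSet hc hf (hreg hy)
  have hd' : ∀ y ∈ Icc a b, HasDerivAt (deriv f) (deriv (deriv f) y) y := fun y hy =>
    ContDiffOn.hasDerivAt_regSet hc (ContDiffOn.deriv_regSet hc hf) (hreg hy)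
  have hM : ∀ y ∈ Icc a b, HasDerivAt (fun y => f y * ‖deriv c y‖ * curv c y)
      (deriv (fun y => f y * ‖deriv c y‖ * curv c y) y) y := fun y hy =>
    ContDiffOn.hasDerivAt_regSet hc ((hf.mul (contDiffOn_speed hc)).mul (contDiffOn_curv hc))
      (hreg hy)
  have hV₁0 : ∀ y ∈ Icc a b, V₁ y 0 = -(deriv f y * utangent c y 1)
      - f y * ‖deriv c y‖ * curv c y * utangent c y 0 := by
    intro y hy
    have hE : EqOn (fun z => V z 0) (fun z => -(f z * utangent c z 1)) (Icc a b) := fun z hz => by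
      simp [h z hz, unormal]
    rw [((hV y).euclidean_apply 0).eq_of_eqOn_Icc hab hE hy
      ((hd y hy).mul (hasDerivAt_utangent hc (hreg hy)).2).neg]
    ring
  have hV₁1 : ∀ y ∈ Icc a b, V₁ y 1 = deriv f y * utangent c y 0
      - f y * ‖deriv c y‖ * curv c y * utangent c y 1 := by
    intro y hy
    have hE : EqOn (fun z => V z 1) (fun z => f z * utangent c z 0) (Icc a b) := fun z hz => by
      simp [h z hz, unormal]
    rw [((hV y).euclidean_apply 1).eq_of_eqOn_Icc hab hE hy
      ((hd y hy).mul (hasDerivAt_utangent hc (hreg hy)).1)]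
    ring
  refine ⟨hV₁0 x hx, hV₁1 x hx, ?_, ?_⟩
  · rw [((hV₁ x).euclidean_apply 0).eq_of_eqOn_Icc hab hV₁0 hx
      ((((hd' x hx).mul (hasDerivAt_utangent hc (hreg hx)).2).neg).sub
        ((hM x hx).mul (hasDerivAt_utangent hc (hreg hx)).1))]
    ring
  · rw [((hV₁ x).euclidean_apply 1).eq_of_eqOn_Icc hab hV₁1 hx
      (((hd' x hx).mul (hasDerivAt_utangent hc (hreg hx)).1).sub
        ((hM x hx).mul (hasDerivAt_utangent hc (hreg hx)).2))]
    ring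

/-- First variation of `∫ k² ds` for the sixth order flow, after integration by parts. -/
theorem integral_variation_eq {c : ℝ → E2} (hc : ContDiff ℝ (⊤ : ℕ∞) c)
    (hreg : Icc (-1 : ℝ) 1 ⊆ regSet c) (h1 : kds c 1 (-1) = 0 ∧ kds c 1 1 = 0)
    (h3 : kds c 3 (-1) = 0 ∧ kds c 3 1 = 0)
    (hF : deriv (speedF c) (-1) = 0 ∧ deriv (speedF c) 1 = 0) :
    ∫ x in (-1 : ℝ)..1, (2 * curv c x * (deriv (deriv (speedF c)) x / ‖deriv c x‖
        - deriv (fun y => ‖deriv c y‖) x * deriv (speedF c) x / ‖deriv c x‖ ^ 2)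
        + curv c x ^ 3 * speedF c x * ‖deriv c x‖) =
      -2 * knorm2 c 3
        + 5 * cint c (fun x => (kds c 2 x) ^ 2 * (curv c x) ^ 2)
        + 5 * cint c (fun x => kds c 2 x * (kds c 1 x) ^ 2 * curv c x)
        + cint c (fun x => kds c 2 x * (curv c x) ^ 5)
        - 1 / 2 * cint c (fun x => (kds c 1 x) ^ 2 * (curv c x) ^ 4) := by
  have hIcc : uIcc (-1 : ℝ) 1 = Icc (-1) 1 := uIcc_of_le (by norm_num)
  have hcg : ContinuousOn (fun x => ‖deriv c x‖) (Icc (-1 : ℝ) 1) :=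
    (contDiffOn_speed hc).continuousOn.mono hreg
  have hck : ∀ j, ContinuousOn (kds c j) (Icc (-1 : ℝ) 1) := fun j =>
    (contDiffOn_kds hc j).continuousOn.mono hreg
  have hck0 : ContinuousOn (curv c) (Icc (-1 : ℝ) 1) := hck 0
  have hii : ∀ {f : ℝ → ℝ}, ContinuousOn f (Icc (-1 : ℝ) 1) →
      IntervalIntegrable f volume (-1) 1 := fun hf =>
    ContinuousOn.intervalIntegrable (hIcc ▸ hf)
  have hcF := (contDiffOn_speedF hc).continuousOn.mono hreg
  have hF1 := ContDiffOn.deriv_regSet hc (contDiffOn_speedF hc)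
  have hcF1 := hF1.continuousOn.mono hreg
  have hcF2 := (ContDiffOn.deriv_regSet hc hF1).continuousOn.mono hreg
  have hcg1 := (ContDiffOn.deriv_regSet hc (contDiffOn_speed hc)).continuousOn.mono hreg
  have hg0 : ∀ x ∈ Icc (-1 : ℝ) 1, ‖deriv c x‖ ≠ 0 := fun x hx => (norm_deriv_pos (hreg hx)).ne'
  have hg2 : ∀ x ∈ Icc (-1 : ℝ) 1, ‖deriv c x‖ ^ 2 ≠ 0 := fun x hx => pow_ne_zero 2 (hg0 x hx)
  have i1 : IntervalIntegrable (fun x => kds c 3 x ^ 2 * ‖deriv c x‖) volume (-1) 1 :=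
    hii (((hck 3).pow 2).mul hcg)
  have i2 : IntervalIntegrable (fun x => kds c 2 x ^ 2 * curv c x ^ 2 * ‖deriv c x‖)
      volume (-1) 1 := hii ((((hck 2).pow 2).mul (hck0.pow 2)).mul hcg)
  have i3 : IntervalIntegrable (fun x => kds c 2 x * kds c 1 x ^ 2 * curv c x * ‖deriv c x‖)
      volume (-1) 1 := hii ((((hck 2).mul ((hck 1).pow 2)).mul hck0).mul hcg)
  have i4 : IntervalIntegrable (fun x => kds c 2 x * curv c x ^ 5 * ‖deriv c x‖)
      volume (-1) 1 := hii (((hck 2).mul (hck0.pow 5)).mul hcg)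
  have i5 : IntervalIntegrable (fun x => kds c 1 x ^ 2 * curv c x ^ 4 * ‖deriv c x‖)
      volume (-1) 1 := hii ((((hck 1).pow 2).mul (hck0.pow 4)).mul hcg)
  have hI : IntervalIntegrable (fun x => 2 * curv c x * (deriv (deriv (speedF c)) x / ‖deriv c x‖
        - deriv (fun y => ‖deriv c y‖) x * deriv (speedF c) x / ‖deriv c x‖ ^ 2)
        + curv c x ^ 3 * speedF c x * ‖deriv c x‖) volume (-1) 1 :=
    hii (((continuousOn_const.mul hck0).mul ((hcF2.div hcg hg0).sub
      ((hcg1.mul hcF1).div (hcg.pow 2) hg2))).add (((hck0.pow 3).mul hcF).mul hcg))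
  have hR := ((((i1.const_mul (-2)).add (i2.const_mul 5)).add (i3.const_mul 5)).add i4).sub
    (i5.const_mul (1 / 2))
  have hP : ∀ x ∈ uIcc (-1 : ℝ) 1, HasDerivAt
      (fun x => 2 * curv c x * (deriv (speedF c) x / ‖deriv c x‖) - 2 * kds c 1 x * speedF c x
        + 2 * kds c 2 x * kds c 3 x + curv c x ^ 3 * kds c 3 x
        - 3 * curv c x ^ 2 * kds c 1 x * kds c 2 x)
      ((2 * curv c x * (deriv (deriv (speedF c)) x / ‖deriv c x‖
        - deriv (fun y => ‖deriv c y‖) x * deriv (speedF c) x / ‖deriv c x‖ ^ 2)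
        + curv c x ^ 3 * speedF c x * ‖deriv c x‖)
        - (-2 * (kds c 3 x ^ 2 * ‖deriv c x‖) + 5 * (kds c 2 x ^ 2 * curv c x ^ 2 * ‖deriv c x‖)
          + 5 * (kds c 2 x * kds c 1 x ^ 2 * curv c x * ‖deriv c x‖)
          + kds c 2 x * curv c x ^ 5 * ‖deriv c x‖
          - 1 / 2 * (kds c 1 x ^ 2 * curv c x ^ 4 * ‖deriv c x‖))) x := by
    intro x hx
    rw [hIcc] at hx
    have hxr := hreg hx
    have hg := hg0 x hx
    have d0 : HasDerivAt (curv c) (‖deriv c x‖ * kds c 1 x) x := hasDerivAt_kds hc 0 hxr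
    have d1 := hasDerivAt_kds hc 1 hxr
    have d2 := hasDerivAt_kds hc 2 hxr
    have d3 := hasDerivAt_kds hc 3 hxr
    have dF := ContDiffOn.hasDerivAt_regSet hc (contDiffOn_speedF hc) hxr
    have dF1 := ContDiffOn.hasDerivAt_regSet hc hF1 hxr
    have dg := ContDiffOn.hasDerivAt_regSet hc (contDiffOn_speed hc) hxr
    refine ((((((d0.const_mul 2).mul (dF1.div dg hg)).sub ((d1.const_mul 2).mul dF)).add
      ((d2.const_mul 2).mul d3)).add ((d0.pow 3).mul d3)).sub
      ((((d0.pow 2).const_mul 3).mul d1).mul d2)).congr_deriv ?_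
    simp only [Pi.mul_apply, Pi.pow_apply, Pi.div_apply, Nat.reduceAdd]
    have hFx : speedF c x = kds c 4 x + curv c x ^ 2 * kds c 2 x
      - 1 / 2 * curv c x * kds c 1 x ^ 2 := rfl
    rw [hFx]
    field_simp
    ring
  have hftc := integral_eq_sub_of_hasDerivAt hP (hI.sub hR)
  rw [intervalIntegral.integral_sub hI hR] at hftc
  simp only [h1.1, h1.2, h3.1, h3.2, hF.1, hF.2, zero_div, mul_zero, zero_mul, sub_zero,
    add_zero] at hftc
  rw [sub_eq_zero.1 hftc, intervalIntegral.integral_sub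
    ((((i1.const_mul (-2)).add (i2.const_mul 5)).add (i3.const_mul 5)).add i4)
    (i5.const_mul (1 / 2)), intervalIntegral.integral_add
    (((i1.const_mul (-2)).add (i2.const_mul 5)).add (i3.const_mul 5)) i4,
    intervalIntegral.integral_add ((i1.const_mul (-2)).add (i2.const_mul 5)) (i3.const_mul 5),
    intervalIntegral.integral_add (i1.const_mul (-2)) (i2.const_mul 5)]
  simp only [intervalIntegral.integral_const_mul]
  rfl

theorem eventually_inTime {T : ℝ≥0∞} {t : ℝ} (ht : inTime T t) :
    ∀ᶠ u in 𝓝[Ici 0] t, inTime T u := by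
  have h : ∀ᶠ u in 𝓝 t, ENNReal.ofReal u < T :=
    ENNReal.continuous_ofReal.continuousAt.eventually_lt continuousAt_const ht.2
  filter_upwards [self_mem_nhdsWithin, h.filter_mono nhdsWithin_le_nhds] with u hu hu'
    using ⟨hu, hu'⟩

theorem deriv_slice_eq {f : ℝ → ℝ → E2} (hf : ContDiff ℝ (⊤ : ℕ∞) (Function.uncurry f)) (u : ℝ) :
    deriv (f u) = fun x => fderiv ℝ (Function.uncurry f) (u, x) (0, 1) :=
  funext fun _ => (hasDerivAt_slice_snd (hf.differentiable (by simp) _)).deriv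

theorem contDiffOn_energyDensity {A B : ℝ × ℝ → E2} (hA : ContDiff ℝ (⊤ : ℕ∞) A)
    (hB : ContDiff ℝ (⊤ : ℕ∞) B) :
    ContDiffOn ℝ 1 (fun p => energyDensity (A p) (B p)) {p | A p ≠ 0} := by
  have hc : ∀ {f : ℝ × ℝ → E2} (i : Fin 2), ContDiff ℝ (⊤ : ℕ∞) f →
      ContDiffOn ℝ 1 (fun p => f p i) {p | A p ≠ 0} := fun i hf =>
    (((EuclideanSpace.proj (𝕜 := ℝ) i).contDiff.comp hf).of_le (by norm_cast)).contDiffOn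
  have hn : ContDiffOn ℝ 1 (fun p => ‖A p‖) {p | A p ≠ 0} :=
    (hA.of_le (by norm_cast)).contDiffOn.norm ℝ fun _ hp => hp
  exact ((((hc 0 hA).mul (hc 1 hB)).sub ((hc 1 hA).mul (hc 0 hB))).div (hn.pow 3)
    fun p hp => pow_ne_zero 3 (norm_ne_zero_iff.2 hp)).pow 2 |>.mul hn

/-- The Neumann condition forces `F_s = 0` at an endpoint. -/
theorem deriv_speedF_eq_zero {T : ℝ≥0∞} (Φ : SixthFlow T) {t : ℝ} (ht : inTime T t) {x : ℝ}
    (hx : x ∈ Icc (-1 : ℝ) 1) (hν : ∀ u, inTime T u → unormal (Φ.γ u) x 0 = 0)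
    (h : fderiv ℝ (fun q => fderiv ℝ (Function.uncurry Φ.γ) q (1, 0)) (t, x) (0, 1) 1 =
      deriv (speedF (Φ.γ t)) x * utangent (Φ.γ t) x 0
        - speedF (Φ.γ t) x * ‖deriv (Φ.γ t) x‖ * curv (Φ.γ t) x * utangent (Φ.γ t) x 1) :
    deriv (speedF (Φ.γ t)) x = 0 := by
  have hτ : ∀ u, inTime T u → utangent (Φ.γ u) x 1 = 0 := fun u hu => by
    simpa [unormal] using hν u hu
  have hA := Φ.smooth.fderiv_apply_const (0, 1)
  have hd := (hasDerivAt_slice_fst (u := t) (x := x)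
    (hA.differentiable (by simp) (t, x))).euclidean_apply 1
  have hzero : ∀ u, inTime T u → fderiv ℝ (Function.uncurry Φ.γ) (u, x) (0, 1) 1 = 0 := by
    intro u hu
    rw [← congrFun (deriv_slice_eq Φ.smooth u) x, deriv_curve_apply (Φ.regular hu hx), hτ u hu,
      mul_zero]
  have h0 : fderiv ℝ (fun q => fderiv ℝ (Function.uncurry Φ.γ) q (0, 1)) (t, x) (1, 0) 1 = 0 :=
    (uniqueDiffOn_Ici (0 : ℝ) t ht.1).eq_deriv _ hd.hasDerivWithinAt
      ((hasDerivWithinAt_const t (Ici 0) (0 : ℝ)).congr_of_eventuallyEq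
        ((eventually_inTime ht).mono hzero) (hzero t ht))
  rw [fderiv_fderiv_apply_comm Φ.smooth, h, hτ t ht, mul_zero, sub_zero] at h0
  refine (mul_eq_zero.1 h0).resolve_right fun hp => ?_
  have := utangent_sq (Φ.regular ht hx)
  simp [hp, hτ t ht] at this

/-- **Evolution of `‖k‖₂²`.**  Under the flow with the stated boundary conditions,
`(d/dt) ∫_γ k² ds = -2 ∫_γ k_{s³}² ds + 5 ∫_γ k_{ss}² k² ds + 5 ∫_γ k_{ss} k_s² k ds
  + ∫_γ k_{ss} k⁵ ds - (1/2) ∫_γ k_s² k⁴ ds`. -/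
theorem evolution_k_L2 {T : ℝ≥0∞} (Φ : SixthFlow T) (e : ℝ) (B : BC Φ e)
    {t : ℝ} (ht : inTime T t) :
    HasDerivWithinAt (fun u => knorm2 (Φ.γ u) 0)
      (-2 * knorm2 (Φ.γ t) 3
        + 5 * cint (Φ.γ t) (fun x => (kds (Φ.γ t) 2 x) ^ 2 * (curv (Φ.γ t) x) ^ 2)
        + 5 * cint (Φ.γ t) (fun x => kds (Φ.γ t) 2 x * (kds (Φ.γ t) 1 x) ^ 2 * curv (Φ.γ t) x)
        + cint (Φ.γ t) (fun x => kds (Φ.γ t) 2 x * (curv (Φ.γ t) x) ^ 5)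
        - 1 / 2 * cint (Φ.γ t) (fun x => (kds (Φ.γ t) 1 x) ^ 2 * (curv (Φ.γ t) x) ^ 4))
      (Ici 0) t := by
  set Γ := Function.uncurry Φ.γ
  have hsm : ContDiff ℝ (⊤ : ℕ∞) Γ := Φ.smooth
  set A : ℝ × ℝ → E2 := fun q => fderiv ℝ Γ q (0, 1)
  set V : ℝ × ℝ → E2 := fun q => fderiv ℝ Γ q (1, 0)
  set A₂ : ℝ × ℝ → E2 := fun q => fderiv ℝ A q (0, 1) with hA₂def
  set V₁ : ℝ × ℝ → E2 := fun q => fderiv ℝ V q (0, 1)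
  set V₂ : ℝ × ℝ → E2 := fun q => fderiv ℝ V₁ q (0, 1)
  have hA : ContDiff ℝ (⊤ : ℕ∞) A := hsm.fderiv_apply_const _
  have hV : ContDiff ℝ (⊤ : ℕ∞) V := hsm.fderiv_apply_const _
  have hA₂ : ContDiff ℝ (⊤ : ℕ∞) A₂ := hA.fderiv_apply_const _
  have hV₁ : ContDiff ℝ (⊤ : ℕ∞) V₁ := hV.fderiv_apply_const _
  have hdiff : ∀ {f : ℝ × ℝ → E2}, ContDiff ℝ (⊤ : ℕ∞) f → Differentiable ℝ f := fun hf =>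
    hf.differentiable (by simp)
  have hγ : ∀ u, ContDiff ℝ (⊤ : ℕ∞) (Φ.γ u) := fun u =>
    hsm.comp (contDiff_const.prodMk contDiff_id)
  have hγ₁ : ∀ u, deriv (Φ.γ u) = fun x => A (u, x) := deriv_slice_eq hsm
  have hγ₂ : ∀ u x, deriv (deriv (Φ.γ u)) x = A₂ (u, x) := fun u x => by
    rw [hγ₁]
    exact (hasDerivAt_slice_snd (hdiff hA _)).deriv
  have hcomm : (fun q => fderiv ℝ A q (1, 0)) = V₁ :=
    funext fun q => fderiv_fderiv_apply_comm hsm q _ _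
  have hcomm₂ : ∀ q, fderiv ℝ A₂ q (1, 0) = V₂ q := fun q => by
    rw [hA₂def, fderiv_fderiv_apply_comm hA, hcomm]
  have hreg : Icc (-1 : ℝ) 1 ⊆ regSet (Φ.γ t) := fun x hx => Φ.regular ht hx
  have hvel : ∀ x ∈ Icc (-1 : ℝ) 1, V (t, x) = speedF (Φ.γ t) x • unormal (Φ.γ t) x :=
    fun x hx => (uniqueDiffOn_Ici (0 : ℝ) t ht.1).eq_deriv _
      (hasDerivAt_slice_fst (hdiff hsm (t, x))).hasDerivWithinAt (Φ.flow ht hx)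
  have hvar := fun x hx => normal_variation_derivs (hγ t) (by norm_num : (-1 : ℝ) < 1) hreg
    (contDiffOn_speedF (hγ t)) (V := fun x => V (t, x)) (V₁ := fun x => V₁ (t, x))
    (V₂ := fun x => V₂ (t, x)) (fun _ => hasDerivAt_slice_snd (hdiff hV _))
    (fun _ => hasDerivAt_slice_snd (hdiff hV₁ _)) hvel (x := x) hx
  have hl : (-1 : ℝ) ∈ Icc (-1 : ℝ) 1 := by norm_num
  have hr : (1 : ℝ) ∈ Icc (-1 : ℝ) 1 := by norm_num
  rw [← integral_variation_eq (hγ t) hreg (B.noflux ht) (B.noflux3 ht)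
    ⟨deriv_speedF_eq_zero Φ ht hl (fun u hu => (B.neumann hu).1) (hvar _ hl).2.1,
      deriv_speedF_eq_zero Φ ht hr (fun u hu => (B.neumann hu).2) (hvar _ hr).2.1⟩]
  set J : ℝ × ℝ → ℝ := fun p => energyDensity (A p) (A₂ p) with hJ
  have hWopen : IsOpen {p | A p ≠ 0} := isOpen_ne_fun hA.continuous continuous_const
  have hJsm : ContDiffOn ℝ 1 J {p | A p ≠ 0} := contDiffOn_energyDensity hA hA₂
  have hW : ∀ x ∈ Icc (-1 : ℝ) 1, (t, x) ∈ {p | A p ≠ 0} := fun x hx => by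
    have h := Φ.regular ht hx
    rwa [hγ₁] at h
  have hknorm : ∀ u, inTime T u → knorm2 (Φ.γ u) 0 = ∫ x in (-1 : ℝ)..1, J (u, x) := by
    intro u hu
    refine intervalIntegral.integral_congr fun x hx => ?_
    rw [uIcc_of_le (by norm_num)] at hx
    have h := energyDensity_deriv (hγ u) (x := x) (Φ.regular hu hx)
    rw [hγ₂, hγ₁] at h
    simp only [hJ, h, hγ₁]
  have hmain := (hasDerivAt_intervalIntegral_of_contDiffOn hWopen hJsm (by norm_num)
    hW).hasDerivWithinAt (s := Ici 0)
  refine (hmain.congr_of_eventuallyEq ((eventually_inTime ht).mono hknorm)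
    (hknorm t ht)).congr_deriv (intervalIntegral.integral_congr fun x hx => ?_)
  rw [uIcc_of_le (by norm_num)] at hx
  have hJd : HasDerivAt (fun s => J (s, x)) (fderiv ℝ J (t, x) (1, 0)) t :=
    hasDerivAt_slice_fst ((hJsm.differentiableOn (by norm_num)).differentiableAt
      (hWopen.mem_nhds (hW x hx)))
  have ha : HasDerivAt (fun s => A (s, x)) (V₁ (t, x)) t := by
    have h := hasDerivAt_slice_fst (hdiff hA (t, x))
    rwa [show fderiv ℝ A (t, x) (1, 0) = V₁ (t, x) from congrFun hcomm (t, x)] at h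
  have hb : HasDerivAt (fun s => A₂ (s, x)) (V₂ (t, x)) t := by
    have h := hasDerivAt_slice_fst (hdiff hA₂ (t, x))
    rwa [hcomm₂] at h
  have hfr := deriv_deriv_curve_apply (hγ t) (hreg hx)
  have hAx : A (t, x) = deriv (Φ.γ t) x := by rw [hγ₁]
  obtain ⟨v1, v2, v3, v4⟩ := hvar x hx
  exact hJd.unique (hasDerivAt_energyDensity ha hb (norm_deriv_pos (hreg hx))
    (utangent_sq (hreg hx)) (hAx ▸ deriv_curve_apply (hreg hx) 0)
    (hAx ▸ deriv_curve_apply (hreg hx) 1) (hγ₂ t x ▸ hfr.1) (hγ₂ t x ▸ hfr.2) v1 v2 v3 v4)
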